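/- Let (v_n)_{n≥0} be a real sequence and let n ≥ 5. Define G₅[a,b,c,d] := (4227769/3840000)a² − (551/1600)b² + (17/40)c² − (1/10)d² + (1607/4800)(a−b)² − (39/80)(b−c)² + (2/5)(c−d)² + (7/80)(a−2b+c)² − (2/5)(b−2c+d)² + (1/5)(a−3b+3c−d)². Then the discrete gradient structure identity holds: v_n·∑_{j=0}^{4} b_j^{(5)} v_{n−j} = G₅[v_n, v_{n−1}, v_{n−2}, v_{n−3}] − G₅[v_{n−1}, v_{n−2}, v_{n−3}, v_{n−4}] + (646631/3840000)v_n² + (1/10)(δ₁⁴v_n + 2δ₁²v_{n−1})² + (1/8)(δ₁³v_n + (23/10)δ₁v_{n−1})² + (1/6)(δ₁²v_n + (1787/800)v_{n−1})². Moreover G₅ is nonnegative: G₅[a,b,c,d] = (1198850903/1678080000)a² + (437/900)((4931/6992)a − b)² + (9/40)((23/18)(a−b) + c)² + (1/10)(2(a−b) + 2c − d)² ≥ 0 for all real a, b, c, d. -/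

import Mathlib

noncomputable def bdf5 : ℕ → ℝ
  | 0 => 137/60
  | 1 => -(163/60)
  | 2 => 137/60
  | 3 => -(21/20)
  | 4 => 1/5
  | _ => 0

/-- Backward difference operators: `delta v 0 n = v n`,
`delta v (m+1) n = delta v m n - delta v m (n-1)`. -/
noncomputable def delta (v : ℕ → ℝ) : ℕ → ℕ → ℝ
  | 0, n => v n
  | m+1, n => delta v m n - delta v m (n-1)

/-- `G₅[a,b,c,d]`. -/
noncomputable def G5 (a b c d : ℝ) : ℝ :=
  4227769/3840000 * a^2 - 551/1600 * b^2 + 17/40 * c^2 - 1/10 * d^2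
    + 1607/4800 * (a - b)^2 - 39/80 * (b - c)^2 + 2/5 * (c - d)^2
    + 7/80 * (a - 2*b + c)^2 - 2/5 * (b - 2*c + d)^2 + 1/5 * (a - 3*b + 3*c - d)^2

theorem bdf5_discrete_gradient_structure (v : ℕ → ℝ) (n : ℕ) (hn : 5 ≤ n) :
    (v n * ∑ j ∈ Finset.range 5, bdf5 j * v (n - j) =
      G5 (v n) (v (n-1)) (v (n-2)) (v (n-3))
        - G5 (v (n-1)) (v (n-2)) (v (n-3)) (v (n-4))
        + 646631/3840000 * (v n)^2
        + 1/10 * (delta v 4 n + 2 * delta v 2 (n-1))^2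
        + 1/8 * (delta v 3 n + 23/10 * delta v 1 (n-1))^2
        + 1/6 * (delta v 2 n + 1787/800 * v (n-1))^2) ∧
    ∀ a b c d : ℝ, G5 a b c d =
        1198850903/1678080000 * a^2 + 437/900 * (4931/6992 * a - b)^2
          + 9/40 * (23/18 * (a - b) + c)^2 + 1/10 * (2 * (a - b) + 2*c - d)^2
      ∧ 0 ≤ G5 a b c d := by
  have h2 : n - 1 - 1 = n - 2 := by omega
  have h3 : n - 2 - 1 = n - 3 := by omega
  have h4 : n - 3 - 1 = n - 4 := by omega
  refine ⟨?_, fun a b c d => ?_⟩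
  · simp only [Finset.sum_range_succ, Finset.sum_range_zero, bdf5, delta, G5, h2, h3, h4,
      Nat.sub_zero]
    ring
  · have h : G5 a b c d =
        1198850903/1678080000 * a^2 + 437/900 * (4931/6992 * a - b)^2
          + 9/40 * (23/18 * (a - b) + c)^2 + 1/10 * (2 * (a - b) + 2*c - d)^2 := by
      unfold G5
      ring
    exact ⟨h, h ▸ by positivity⟩
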